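/- For every collection of norms ‖·‖_(r) on V_r (r ∈ ℕ₆) there exists a sequence of functions f_n : ℕ₆ → ℝ (n ≥ 1) such that, writing M_n = M_{f_n} (extended by continuity to a bounded operator on R) and A(n) = supp f_n = {k ∈ ℕ₆ : f_n(k) ≠ 0}, the following hold: (a) sup_n ‖M_n‖ < ∞; (b) if j ∈ A(n) then f_{n+1}(j) = 1; (c) for every j ∈ ℕ₆ there exists m ∈ ℕ with f_m(j) = 1; (d) for every n ≥ 1 and every r ∈ ℕ₆ there exists j > r with j ∈ A(1), and there exists i > j with i ∉ A(n) and {j, j+1, …, i} ⊆ A(n+1). -/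

import Mathlib

open scoped Classical

noncomputable section

/-- `a_r = 5·10^(r−2)`. -/
def aIdx (r : ℕ) : ℕ := 5 * 10 ^ (r - 2)

/-- `b_r = 10^r`. -/
def bIdx (r : ℕ) : ℕ := 10 ^ r

/-- The index set of the subspace `V_r = lin{e_i : a_r < i ≤ b_r}`. -/
def VIdx (r : ℕ) : Set ℕ := {i | aIdx r < i ∧ i ≤ bIdx r}

/-- The index set of the subspace `W_r = lin{e_i : a_{r+1} < i ≤ b_r}`. -/
def WIdx (r : ℕ) : Set ℕ := {i | aIdx (r + 1) < i ∧ i ≤ bIdx r}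

/-- The index set `E(r)`. -/
def EIdx (r : ℕ) : Set ℕ :=
  if r = 6 then {i | aIdx 6 < i ∧ i ≤ bIdx 6} else {i | bIdx (r - 1) < i ∧ i ≤ bIdx r}

/-- The vector space `V` with basis `{e_i : i > a_6}`, realized as the space of finitely
supported real families indexed by `{i : ℕ // a_6 < i}`. -/
abbrev Vb : Type := {i : ℕ // aIdx 6 < i} →₀ ℝ

/-- `x ∈ V` is supported in the index set `s ⊆ ℕ`. -/
def SuppIn (x : Vb) (s : Set ℕ) : Prop := ∀ i, x i ≠ 0 → (i : ℕ) ∈ s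

/-- The coordinate projection of `V` onto the coordinates lying in `s` (e.g. `π_r^V`, `π_r^W`
for `s = VIdx r`, `WIdx r`). -/
def projTo (s : Set ℕ) : Vb →ₗ[ℝ] Vb where
  toFun x := Finsupp.onFinset x.support (fun i => if (i : ℕ) ∈ s then x i else 0)
    (fun i h => Finsupp.mem_support_iff.2 (fun hx => h (by simp [hx])))
  map_add' x y := by
    ext i
    by_cases h : (i : ℕ) ∈ s <;> simp [Finsupp.onFinset_apply, h]
  map_smul' c x := by
    ext i
    by_cases h : (i : ℕ) ∈ s <;> simp [Finsupp.onFinset_apply, h]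

/-- `N` is a norm on the coordinate subspace of `V` supported in `s`. -/
structure IsNormOn (N : Vb → ℝ) (s : Set ℕ) : Prop where
  nonneg : ∀ x, SuppIn x s → 0 ≤ N x
  eq_zero_iff : ∀ x, SuppIn x s → N x = 0 → x = 0
  add_le : ∀ x y, SuppIn x s → SuppIn y s → N (x + y) ≤ N x + N y
  smul : ∀ (c : ℝ) (x), SuppIn x s → N (c • x) = |c| * N x

/-- A collection of norms `‖·‖_(r)` on the spaces `V_r`, `r ∈ ℕ₆`. -/
def NormFamily (N : ℕ → Vb → ℝ) : Prop := ∀ r, 6 ≤ r → IsNormOn (N r) (VIdx r)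

/-- The norm on `V` induced by the collection `N`:
`‖x‖² = Σ_{r≥6} [‖π_r^V x‖_(r)² + (1/log r)(‖π_r^W x‖_(r)² + ‖π_r^W x‖_(r+1)²)]`. -/
def VNorm (N : ℕ → Vb → ℝ) (x : Vb) : ℝ :=
  Real.sqrt (∑' r : ℕ,
    if 6 ≤ r then
      N r (projTo (VIdx r) x) ^ 2 +
        (1 / Real.log r) *
          (N r (projTo (WIdx r) x) ^ 2 + N (r + 1) (projTo (WIdx r) x) ^ 2)
    else 0)

/-- The unique block `j ∈ ℕ₆` with `i ∈ E(j)` (for `i > a_6`). -/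
def blockOf (i : ℕ) : ℕ := max 6 (Nat.clog 10 i)

/-- The multiplier `M_f`, acting on `e_i` as multiplication by `f(j)` for `i ∈ E(j)`. -/
def Mf (f : ℕ → ℝ) : Vb →ₗ[ℝ] Vb where
  toFun x := Finsupp.onFinset x.support (fun i => f (blockOf i) * x i)
    (fun i h => Finsupp.mem_support_iff.2 (fun hx => h (by simp [hx])))
  map_add' x y := by
    ext i
    simp [Finsupp.onFinset_apply, mul_add]
  map_smul' c x := by
    ext i
    simp [Finsupp.onFinset_apply]
    ring

/-- The `r`-th summand of the square of `VNorm N x`. -/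
def normTerm (N : ℕ → Vb → ℝ) (x : Vb) (r : ℕ) : ℝ :=
  if 6 ≤ r then
    N r (projTo (VIdx r) x) ^ 2 +
      (1 / Real.log r) *
        (N r (projTo (WIdx r) x) ^ 2 + N (r + 1) (projTo (WIdx r) x) ^ 2)
  else 0

lemma projTo_apply (s : Set ℕ) (x : Vb) (i : {i : ℕ // aIdx 6 < i}) :
    projTo s x i = if (i : ℕ) ∈ s then x i else 0 := rfl

lemma Mf_apply (f : ℕ → ℝ) (x : Vb) (i : {i : ℕ // aIdx 6 < i}) :
    Mf f x i = f (blockOf i) * x i := rfl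

lemma suppIn_projTo {s t : Set ℕ} (h : s ⊆ t) (x : Vb) : SuppIn (projTo s x) t := by
  intro i hi
  rw [projTo_apply] at hi
  by_cases his : (i : ℕ) ∈ s
  · exact h his
  · simp [his] at hi

lemma IsNormOn.map_zero {N : Vb → ℝ} {s : Set ℕ} (h : IsNormOn N s) : N 0 = 0 := by
  simpa using h.smul 0 0 (fun i hi => absurd rfl hi)

lemma SuppIn.smul {x : Vb} {s : Set ℕ} (hx : SuppIn x s) (c : ℝ) : SuppIn (c • x) s :=
  fun i hi => hx i fun h => hi (by simp [h])

lemma aIdx_succ {r : ℕ} (hr : 2 ≤ r) : aIdx (r + 1) = 10 * aIdx r := by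
  obtain ⟨k, rfl⟩ := Nat.exists_eq_add_of_le' hr
  simp only [aIdx, show k + 2 + 1 - 2 = k + 1 by omega, show k + 2 - 2 = k by omega, pow_succ]
  ring

lemma two_mul_aIdx_succ {r : ℕ} (hr : 1 ≤ r) : 2 * aIdx (r + 1) = bIdx r := by
  obtain ⟨k, rfl⟩ := Nat.exists_eq_add_of_le' hr
  simp only [aIdx, bIdx, show k + 1 + 1 - 2 = k by omega, pow_succ]
  ring

lemma bIdx_succ (r : ℕ) : bIdx (r + 1) = 10 * bIdx r := by
  simp only [bIdx, pow_succ]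
  ring

lemma WIdx_subset_VIdx {r : ℕ} (hr : 2 ≤ r) : WIdx r ⊆ VIdx r := by
  rintro i ⟨h1, h2⟩
  have := aIdx_succ hr
  exact ⟨by omega, h2⟩

lemma WIdx_subset_VIdx_succ (r : ℕ) : WIdx r ⊆ VIdx (r + 1) := by
  rintro i ⟨h1, h2⟩
  have := bIdx_succ r
  exact ⟨h1, by omega⟩

lemma blockOf_eq {r i : ℕ} (hr : 5 ≤ r) (h1 : bIdx r < i) (h2 : i ≤ bIdx (r + 1)) :
    blockOf i = r + 1 := by
  have h3 : Nat.clog 10 i ≤ r + 1 := (Nat.clog_le_iff_le_pow (by norm_num)).2 h2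
  have h4 : r < Nat.clog 10 i := (Nat.lt_clog_iff_pow_lt (by norm_num)).2 h1
  unfold blockOf
  omega

lemma blockOf_eq_six {i : ℕ} (h : i ≤ bIdx 6) : blockOf i = 6 := by
  have h3 : Nat.clog 10 i ≤ 6 := (Nat.clog_le_iff_le_pow (by norm_num)).2 h
  unfold blockOf
  omega

lemma blockOf_of_mem_WIdx {r i : ℕ} (hr : 6 ≤ r) (h : i ∈ WIdx r) : blockOf i = r := by
  obtain ⟨k, rfl⟩ := Nat.exists_eq_add_of_le' (show 1 ≤ r by omega)
  obtain ⟨h1, h2⟩ := h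
  have h3 := two_mul_aIdx_succ (show 1 ≤ k + 1 by omega)
  have h4 := bIdx_succ k
  exact blockOf_eq (by omega) (by omega) h2

lemma projTo_WIdx_Mf (f : ℕ → ℝ) (x : Vb) {r : ℕ} (hr : 6 ≤ r) :
    projTo (WIdx r) (Mf f x) = f r • projTo (WIdx r) x := by
  ext i
  by_cases hi : (i : ℕ) ∈ WIdx r
  · simp [projTo_apply, Mf_apply, hi, blockOf_of_mem_WIdx hr hi]
  · simp [projTo_apply, hi]

lemma projTo_VIdx_six_Mf (f : ℕ → ℝ) (x : Vb) :
    projTo (VIdx 6) (Mf f x) = f 6 • projTo (VIdx 6) x := by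
  ext i
  by_cases hi : (i : ℕ) ∈ VIdx 6
  · simp [projTo_apply, Mf_apply, hi, blockOf_eq_six hi.2]
  · simp [projTo_apply, hi]

lemma projTo_VIdx_succ_Mf (f : ℕ → ℝ) (x : Vb) {r : ℕ} (hr : 6 ≤ r) :
    projTo (VIdx (r + 1)) (Mf f x) =
      f (r + 1) • projTo (VIdx (r + 1)) x + (f r - f (r + 1)) • projTo (WIdx r) x := by
  ext i
  by_cases hi : (i : ℕ) ∈ WIdx r
  · simp only [projTo_apply, Mf_apply, hi, blockOf_of_mem_WIdx hr hi, WIdx_subset_VIdx_succ r hi,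
      if_true, Finsupp.add_apply, Finsupp.smul_apply, smul_eq_mul]
    ring
  · by_cases hv : (i : ℕ) ∈ VIdx (r + 1)
    · have hb : bIdx r < i := by
        by_contra h
        exact hi ⟨hv.1, not_lt.1 h⟩
      simp [projTo_apply, Mf_apply, hi, hv, blockOf_eq (by omega) hb hv.2]
    · simp [projTo_apply, hi, hv]

lemma normTerm_nonneg (N : ℕ → Vb → ℝ) (x : Vb) (r : ℕ) : 0 ≤ normTerm N x r := by
  unfold normTerm
  have : 0 ≤ Real.log r := Real.log_natCast_nonneg r
  split_ifs <;> positivity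

lemma lt_aIdx {r : ℕ} (hr : 2 ≤ r) : r < aIdx r := by
  obtain ⟨k, rfl⟩ := Nat.exists_eq_add_of_le' hr
  have : k < 10 ^ k := Nat.lt_pow_self (by norm_num)
  simp only [aIdx, show k + 2 - 2 = k by omega]
  omega

lemma summable_normTerm {N : ℕ → Vb → ℝ} (hN : NormFamily N) (x : Vb) :
    Summable (normTerm N x) := by
  refine summable_of_ne_finset_zero
    (s := Finset.range (x.support.sup (fun i => (i : ℕ)) + 1)) fun r hr => ?_
  unfold normTerm
  split_ifs with h6
  · have hzero : ∀ s ⊆ VIdx r, projTo s x = 0 := by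
      intro s hs
      ext i
      rw [projTo_apply]
      split_ifs with his
      · by_contra hx
        have h1 : (i : ℕ) ≤ x.support.sup (fun i => (i : ℕ)) :=
          Finset.le_sup (f := fun i : {i : ℕ // aIdx 6 < i} => (i : ℕ))
            (Finsupp.mem_support_iff.2 hx)
        have h2 := (hs his).1
        have h3 := lt_aIdx (show 2 ≤ r by omega)
        simp only [Finset.mem_range, not_lt] at hr
        omega
      · rfl
    rw [hzero _ subset_rfl, hzero _ (WIdx_subset_VIdx (by omega)), (hN r h6).map_zero,
      (hN (r + 1) (by omega)).map_zero]
    simp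
  · rfl

lemma normTerm_Mf_le {N : ℕ → Vb → ℝ} (hN : NormFamily N) {f : ℕ → ℝ}
    (hf : ∀ k, |f k| ≤ 1) (hd : ∀ k, 6 ≤ k → (f k - f (k + 1)) ^ 2 ≤ 1 / Real.log k)
    (x : Vb) (r : ℕ) :
    normTerm N (Mf f x) (r + 1) ≤ 2 * normTerm N x (r + 1) + 2 * normTerm N x r := by
  by_cases h5 : 5 ≤ r
  swap
  · simp [normTerm, show ¬ 6 ≤ r by omega, show ¬ 6 ≤ r + 1 by omega]
  have hsq : ∀ k, f k ^ 2 ≤ 1 := fun k => (sq_le_one_iff_abs_le_one _).2 (hf k)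
  have hN1 := hN (r + 1) (by omega)
  have hN2 := hN (r + 1 + 1) (by omega)
  have hlog : 0 ≤ 1 / Real.log ((r + 1 : ℕ) : ℝ) :=
    one_div_nonneg.2 (Real.log_natCast_nonneg _)
  have hV : N (r + 1) (projTo (VIdx (r + 1)) (Mf f x)) ^ 2 ≤
      2 * N (r + 1) (projTo (VIdx (r + 1)) x) ^ 2 + 2 * normTerm N x r := by
    obtain rfl | h6 := h5.eq_or_lt
    · have h0 := normTerm_nonneg N x 5
      rw [projTo_VIdx_six_Mf, hN1.smul _ _ (suppIn_projTo subset_rfl x), mul_pow, sq_abs]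
      nlinarith [mul_le_mul_of_nonneg_right (hsq 6) (sq_nonneg (N 6 (projTo (VIdx 6) x))),
        sq_nonneg (N 6 (projTo (VIdx 6) x))]
    · have h6 : 6 ≤ r := h6
      have hs1 := suppIn_projTo (subset_refl (VIdx (r + 1))) x
      have hs2 := suppIn_projTo (WIdx_subset_VIdx_succ r) x
      have hadd := hN1.add_le _ _ (hs1.smul (f (r + 1))) (hs2.smul (f r - f (r + 1)))
      rw [← projTo_VIdx_succ_Mf f x h6, hN1.smul _ _ hs1, hN1.smul _ _ hs2] at hadd
      have h0 := hN1.nonneg (projTo (VIdx (r + 1)) (Mf f x)) (suppIn_projTo subset_rfl _)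
      have hT : 1 / Real.log r * N (r + 1) (projTo (WIdx r) x) ^ 2 ≤ normTerm N x r := by
        have hl : 0 ≤ 1 / Real.log r := one_div_nonneg.2 (Real.log_natCast_nonneg _)
        have := mul_nonneg hl (sq_nonneg (N r (projTo (WIdx r) x)))
        rw [normTerm, if_pos h6, mul_add]
        nlinarith [sq_nonneg (N r (projTo (VIdx r) x))]
      have h1 := mul_le_mul_of_nonneg_right (hsq (r + 1))
        (sq_nonneg (N (r + 1) (projTo (VIdx (r + 1)) x)))
      have h2 := mul_le_mul_of_nonneg_right (hd r h6)
        (sq_nonneg (N (r + 1) (projTo (WIdx r) x)))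
      calc _ ≤ (|f (r + 1)| * N (r + 1) (projTo (VIdx (r + 1)) x) +
            |f r - f (r + 1)| * N (r + 1) (projTo (WIdx r) x)) ^ 2 := pow_le_pow_left₀ h0 hadd 2
        _ ≤ 2 * ((|f (r + 1)| * N (r + 1) (projTo (VIdx (r + 1)) x)) ^ 2 +
            (|f r - f (r + 1)| * N (r + 1) (projTo (WIdx r) x)) ^ 2) := add_sq_le
        _ ≤ _ := by
          rw [mul_pow, mul_pow, sq_abs, sq_abs]
          linarith
  have hW : ∀ M : Vb → ℝ, (∀ c : ℝ, M (c • projTo (WIdx (r + 1)) x) =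
      |c| * M (projTo (WIdx (r + 1)) x)) →
      M (projTo (WIdx (r + 1)) (Mf f x)) ^ 2 ≤ 2 * M (projTo (WIdx (r + 1)) x) ^ 2 := by
    intro M hM
    rw [projTo_WIdx_Mf f x (by omega), hM, mul_pow, sq_abs]
    nlinarith [mul_le_mul_of_nonneg_right (hsq (r + 1))
      (sq_nonneg (M (projTo (WIdx (r + 1)) x))), sq_nonneg (M (projTo (WIdx (r + 1)) x))]
  have hW1 := hW (N (r + 1)) fun c =>
    hN1.smul c _ (suppIn_projTo (WIdx_subset_VIdx (by omega)) x)
  have hW2 := hW (N (r + 1 + 1)) fun c =>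
    hN2.smul c _ (suppIn_projTo (WIdx_subset_VIdx_succ _) x)
  have hWW := mul_le_mul_of_nonneg_left (add_le_add hW1 hW2) hlog
  rw [normTerm, if_pos (by omega), normTerm, if_pos (by omega)]
  linarith

/-- Multipliers bounded by `1` whose increments satisfy `|f(k) - f(k+1)|² ≤ 1 / log k` have norm at
most `2`. -/
lemma VNorm_Mf_le {N : ℕ → Vb → ℝ} (hN : NormFamily N) {f : ℕ → ℝ}
    (hf : ∀ k, |f k| ≤ 1) (hd : ∀ k, 6 ≤ k → (f k - f (k + 1)) ^ 2 ≤ 1 / Real.log k)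
    (x : Vb) : VNorm N (Mf f x) ≤ 2 * VNorm N x := by
  change √(∑' r, normTerm N (Mf f x) r) ≤ 2 * √(∑' r, normTerm N x r)
  have hs := summable_normTerm hN x
  have hs' := (summable_nat_add_iff 1).2 hs
  have hM := summable_normTerm hN (Mf f x)
  have h0 : ∀ y, normTerm N y 0 = 0 := fun y => by simp [normTerm]
  have hle : ∑' r, normTerm N (Mf f x) r ≤ 2 ^ 2 * ∑' r, normTerm N x r := by
    have h1 := hs.tsum_eq_zero_add
    rw [hM.tsum_eq_zero_add, h0, zero_add]
    rw [h0, zero_add] at h1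
    calc ∑' r, normTerm N (Mf f x) (r + 1)
        ≤ ∑' r, (2 * normTerm N x (r + 1) + 2 * normTerm N x r) :=
          ((summable_nat_add_iff 1).2 hM).tsum_le_tsum (normTerm_Mf_le hN hf hd x)
            ((hs'.mul_left 2).add (hs.mul_left 2))
      _ = 2 ^ 2 * ∑' r, normTerm N x r := by
          rw [(hs'.mul_left 2).tsum_add (hs.mul_left 2), tsum_mul_left, tsum_mul_left, ← h1]
          ring
  calc _ ≤ √(2 ^ 2 * ∑' r, normTerm N x r) := Real.sqrt_le_sqrt hle
    _ = _ := by rw [Real.sqrt_mul (by positivity), Real.sqrt_sq (by norm_num)]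

/-- Distance of `log k` to the set of perfect squares. -/
def logSqDist (k : ℕ) : ℝ :=
  Metric.infDist (Real.log k) (Set.range fun m : ℕ => (m : ℝ) ^ 2)

/-- The multiplier function, equal to `1` where `logSqDist ≤ n - 1` and to `0` where
`n ≤ logSqDist`. -/
def plateau (n k : ℕ) : ℝ := if k < 6 then 0 else max 0 (min 1 (n - logSqDist k))

lemma plateau_of_le {n k : ℕ} (hk : 6 ≤ k) :
    plateau n k = max 0 (min 1 (n - logSqDist k)) := by
  rw [plateau, if_neg (by omega)]

lemma abs_plateau_le_one (n k : ℕ) : |plateau n k| ≤ 1 := by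
  unfold plateau
  split_ifs
  · simp
  · rw [abs_of_nonneg (le_max_left _ _)]
    exact max_le zero_le_one (min_le_left _ _)

lemma plateau_eq_one {n k : ℕ} (hk : 6 ≤ k) (h : logSqDist k + 1 ≤ n) : plateau n k = 1 := by
  rw [plateau_of_le hk, min_eq_left (by linarith), max_eq_right zero_le_one]

lemma plateau_ne_zero_iff {n k : ℕ} (hk : 6 ≤ k) : plateau n k ≠ 0 ↔ logSqDist k < n := by
  rw [plateau_of_le hk, ← not_le, not_iff_not]
  rw [max_eq_left_iff, min_le_iff, sub_nonpos]
  simp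

lemma plateau_sub_sq_le (n : ℕ) {k : ℕ} (hk : 6 ≤ k) :
    (plateau n k - plateau n (k + 1)) ^ 2 ≤ 1 / Real.log k := by
  have hk0 : (6 : ℝ) ≤ k := by exact_mod_cast hk
  have h1 : |plateau n k - plateau n (k + 1)| ≤ |Real.log k - Real.log (k + 1)| := by
    rw [plateau_of_le hk, plateau_of_le (by omega)]
    calc _ ≤ |min 1 ((n : ℝ) - logSqDist k) - min 1 (n - logSqDist (k + 1))| := by
          simpa only [max_comm] using abs_max_sub_max_le_abs
            (min 1 ((n : ℝ) - logSqDist k)) (min 1 (n - logSqDist (k + 1))) 0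
      _ ≤ |((n : ℝ) - logSqDist k) - (n - logSqDist (k + 1))| := by
          simpa using abs_min_sub_min_le_max 1 ((n : ℝ) - logSqDist k) 1
            (n - logSqDist (k + 1))
      _ = dist (logSqDist k) (logSqDist (k + 1)) := by
          rw [Real.dist_eq, abs_sub_comm]
          congr 1
          ring
      _ ≤ dist (Real.log k) (Real.log (k + 1)) := by
          simpa [logSqDist] using (Metric.lipschitz_infDist_pt
            (Set.range fun m : ℕ => (m : ℝ) ^ 2)).dist_le_mul (Real.log k) (Real.log (k + 1))
      _ = _ := Real.dist_eq _ _
  have h2 : |Real.log k - Real.log (k + 1)| ≤ 1 / k := by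
    rw [abs_sub_comm, ← Real.log_div (by positivity) (by positivity),
      abs_of_nonneg (Real.log_nonneg (by rw [le_div_iff₀ (by positivity)]; linarith))]
    refine (Real.log_le_sub_one_of_pos (by positivity)).trans (le_of_eq ?_)
    field_simp
    ring
  have hlog : 0 < Real.log k := Real.log_pos (by linarith)
  have hlog' : Real.log k ≤ k := (Real.log_le_sub_one_of_pos (by linarith)).trans (by linarith)
  calc _ = |plateau n k - plateau n (k + 1)| ^ 2 := (sq_abs _).symm
    _ ≤ (1 / k) ^ 2 := pow_le_pow_left₀ (abs_nonneg _) (h1.trans h2) 2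
    _ = 1 / (k : ℝ) ^ 2 := by rw [div_pow, one_pow]
    _ ≤ 1 / Real.log k := one_div_le_one_div_of_le hlog (by nlinarith)

lemma logSqDist_le (k m : ℕ) : logSqDist k ≤ |Real.log k - (m : ℝ) ^ 2| :=
  Metric.infDist_le_dist_of_mem (Set.mem_range_self m)

lemma log_ceil_exp_lt {t : ℝ} (ht : 0 ≤ t) : Real.log ⌈Real.exp t⌉₊ < t + 1 := by
  have h1 := Nat.ceil_lt_add_one (Real.exp_pos t).le
  have h2 := Nat.le_ceil (Real.exp t)
  have h3 := Real.one_le_exp ht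
  rw [Real.log_lt_iff_lt_exp (by linarith), Real.exp_add]
  nlinarith [Real.exp_one_gt_d9]

lemma le_log_ceil_exp (t : ℝ) : t ≤ Real.log ⌈Real.exp t⌉₊ := by
  have h2 := Nat.le_ceil (Real.exp t)
  rwa [Real.le_log_iff_exp_le ((Real.exp_pos t).trans_le h2)]

lemma le_logSqDist {k n i : ℕ} (hk : n ≤ k) (h1 : (k : ℝ) ^ 2 + n ≤ Real.log i)
    (h2 : Real.log i < (k : ℝ) ^ 2 + n + 1) : n ≤ logSqDist i := by
  refine (Metric.le_infDist (Set.range_nonempty _)).2 ?_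
  rintro _ ⟨m, rfl⟩
  have hk' : (n : ℝ) ≤ k := by exact_mod_cast hk
  rw [Real.dist_eq, le_abs]
  rcases le_or_gt m k with hm | hm
  · left
    have : (m : ℝ) ^ 2 ≤ (k : ℝ) ^ 2 := by
      exact_mod_cast Nat.pow_le_pow_left hm 2
    simp only
    linarith
  · right
    have : ((k : ℝ) + 1) ^ 2 ≤ (m : ℝ) ^ 2 := by
      exact_mod_cast Nat.pow_le_pow_left (show k + 1 ≤ m from hm) 2
    simp only
    nlinarith

lemma exists_plateau_gap {n : ℕ} (hn : 1 ≤ n) {r : ℕ} (hr : 6 ≤ r) :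
    ∃ j, r < j ∧ plateau 1 j ≠ 0 ∧ ∃ i, j < i ∧ plateau n i = 0 ∧
      ∀ q, j ≤ q → q ≤ i → plateau (n + 1) q ≠ 0 := by
  set k := n + r with hk
  set j := ⌈Real.exp ((k : ℝ) ^ 2)⌉₊ with hj
  set i := ⌈Real.exp ((k : ℝ) ^ 2 + n)⌉₊ with hi
  have hn' : (1 : ℝ) ≤ n := by exact_mod_cast hn
  have hj1 : (k : ℝ) ^ 2 ≤ Real.log j := le_log_ceil_exp _
  have hj2 : Real.log j < (k : ℝ) ^ 2 + 1 := log_ceil_exp_lt (by positivity)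
  have hi1 : (k : ℝ) ^ 2 + n ≤ Real.log i := le_log_ceil_exp _
  have hi2 : Real.log i < (k : ℝ) ^ 2 + n + 1 := log_ceil_exp_lt (by positivity)
  have hrj : r < j := by
    have hrk : (r : ℝ) ≤ k := by exact_mod_cast Nat.le_add_left r n
    have hr' : (6 : ℝ) ≤ r := by exact_mod_cast hr
    have := Real.add_one_le_exp ((k : ℝ) ^ 2)
    have := Nat.le_ceil (Real.exp ((k : ℝ) ^ 2))
    have : (r : ℝ) < j := by nlinarith
    exact_mod_cast this
  have hji : j < i := by
    by_contra h
    have hi0 : 0 < i := Nat.ceil_pos.2 (Real.exp_pos _)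
    have := Real.log_le_log (by exact_mod_cast hi0)
      (show (i : ℝ) ≤ j by exact_mod_cast not_lt.1 h)
    linarith
  refine ⟨j, hrj, (plateau_ne_zero_iff (by omega)).2 ?_, i, hji, ?_, fun q hq1 hq2 =>
    (plateau_ne_zero_iff (by omega)).2 ?_⟩
  · refine (logSqDist_le j k).trans_lt ?_
    rw [abs_of_nonneg (by linarith)]
    push_cast
    linarith
  · by_contra h
    rw [← ne_eq, plateau_ne_zero_iff (by omega)] at h
    exact h.not_ge (le_logSqDist (by omega) hi1 hi2)
  · have hq3 := Real.log_le_log (show (0 : ℝ) < j by exact_mod_cast (by omega : 0 < j))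
      (show (j : ℝ) ≤ q by exact_mod_cast hq1)
    have hq4 := Real.log_le_log (show (0 : ℝ) < q by exact_mod_cast (by omega : 0 < q))
      (show (q : ℝ) ≤ i by exact_mod_cast hq2)
    refine (logSqDist_le q k).trans_lt ?_
    rw [abs_of_nonneg (by linarith)]
    push_cast
    linarith

/-- **Lemma 2.** For every collection of norms `‖·‖_(r)` on the `V_r` there is
a sequence of functions `f_n : ℕ₆ → ℝ` (`n ≥ 1`) such that, with `M_n = M_{f_n}` (extended by
continuity to the completion `R` of `(V, ‖·‖)`) and `A(n) = supp f_n`: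
(a) `sup_n ‖M_n‖ < ∞`;
(b) if `j ∈ A(n)` then `f_{n+1}(j) = 1`;
(c) for every `j ∈ ℕ₆` there is `m` with `f_m(j) = 1`;
(d) for every `n ≥ 1` and `r ∈ ℕ₆` there is `j > r` with `j ∈ A(1)`, and `i > j` with
`i ∉ A(n)` and `{j, …, i} ⊆ A(n+1)`. -/
theorem statement4 (N : ℕ → Vb → ℝ) (hN : NormFamily N) :
    ∃ f : ℕ → ℕ → ℝ,
      -- the `f n` are functions on `ℕ₆`:
      (∀ n k, k < 6 → f n k = 0) ∧
      -- (b)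
      (∀ n j, 1 ≤ n → 6 ≤ j → f n j ≠ 0 → f (n + 1) j = 1) ∧
      -- (c)
      (∀ j, 6 ≤ j → ∃ m, 1 ≤ m ∧ f m j = 1) ∧
      -- (d)
      (∀ n, 1 ≤ n → ∀ r, 6 ≤ r → ∃ j, r < j ∧ f 1 j ≠ 0 ∧
        ∃ i, j < i ∧ f n i = 0 ∧ ∀ q, j ≤ q → q ≤ i → f (n + 1) q ≠ 0) ∧
      -- (a): the multipliers extend to a uniformly bounded family of operators on `R`:
      (∀ (R : Type) [NormedAddCommGroup R] [NormedSpace ℝ R] [CompleteSpace R]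
        (eV : Vb →ₗ[ℝ] R), (∀ x, ‖eV x‖ = VNorm N x) → DenseRange eV →
        ∃ Mb : ℕ → R →L[ℝ] R,
          (∀ n v, Mb n (eV v) = eV (Mf (f n) v)) ∧
          ∃ C : ℝ, ∀ n, 1 ≤ n → ‖Mb n‖ ≤ C) := by
  refine ⟨plateau, fun n k hk => if_pos hk, fun n j _ hj h => ?_, fun j hj => ?_,
    fun n hn r hr => exists_plateau_gap hn hr, ?_⟩
  · rw [plateau_ne_zero_iff hj] at h
    refine plateau_eq_one hj ?_
    push_cast
    linarith
  · obtain ⟨m, hm⟩ := exists_nat_ge (logSqDist j)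
    refine ⟨m + 1, by omega, plateau_eq_one hj ?_⟩
    push_cast
    linarith
  · intro R _ _ _ eV heV hdense
    have hbound : ∀ n v, ‖(eV ∘ₗ Mf (plateau n)) v‖ ≤ 2 * ‖eV v‖ := fun n v => by
      rw [LinearMap.comp_apply, heV, heV]
      exact VNorm_Mf_le hN (abs_plateau_le_one n) (fun k => plateau_sub_sq_le n) v
    exact ⟨fun n => (eV ∘ₗ Mf (plateau n)).extendOfNorm eV,
      fun n v => LinearMap.extendOfNorm_eq hdense ⟨2, hbound n⟩ v,
      2, fun n _ => LinearMap.opNorm_extendOfNorm_le hdense (by norm_num) (hbound n)⟩
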